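/- Let κ = (0,0). Suppose a ≥ 1 and b ≥ 0 with a + b ≤ e, and let λ = ((a,1^b),(a,1^b)). Then there is a unique standard λ-tableau t ≠ t_λ with residue sequence i_t = i_λ; namely, writing t_λ = (t^{(1)}, t^{(2)}), the tableau t = (t^{(2)}, t^{(1)}) obtained by swapping the two components. -/

import Mathlib

open scoped BigOperators

namespace KLRSpecht

/-- Generators of the cyclotomic KLR algebra: idempotents `e(i)` indexed by residue
sequences (as functions `ℕ → ZMod e`, read in positions `1,…,n`), dots `y r` and
crossings `psi r` (1-based). -/
inductive Gen (e : ℕ) : Type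
  | idem : (ℕ → ZMod e) → Gen e
  | y : ℕ → Gen e
  | psi : ℕ → Gen e

def Ee (F : Type) [Field F] (e : ℕ) (i : ℕ → ZMod e) : FreeAlgebra F (Gen e) :=
  FreeAlgebra.ι F (Gen.idem i)

def Yy (F : Type) [Field F] (e : ℕ) (r : ℕ) : FreeAlgebra F (Gen e) :=
  FreeAlgebra.ι F (Gen.y r)

def Pp (F : Type) [Field F] (e : ℕ) (r : ℕ) : FreeAlgebra F (Gen e) :=
  FreeAlgebra.ι F (Gen.psi r)

/-- Two residue sequences agree in positions `1,…,n`. -/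
def Agree (e n : ℕ) (i j : ℕ → ZMod e) : Prop := ∀ r, 1 ≤ r → r ≤ n → i r = j r

/-- The action of the simple transposition `s_r` on residue sequences. -/
def swapSeq (e : ℕ) (r : ℕ) (i : ℕ → ZMod e) : ℕ → ZMod e :=
  fun s => i (Equiv.swap r (r+1) s)

def extendFin (e n : ℕ) (v : Fin n → ZMod e) : ℕ → ZMod e := fun r =>
  if h : 1 ≤ r ∧ r ≤ n then v ⟨r - 1, by omega⟩ else 0

/-- The KLR polynomial `Q_{a,b}(u,v)` for the quiver of type `A_{e-1}^{(1)}`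
(with an arrow `i → i-1` for each `i`), governing the quadratic relations. -/
def Qpoly (F : Type) [Field F] (e : ℕ) (a b : ZMod e) (u v : FreeAlgebra F (Gen e)) :
    FreeAlgebra F (Gen e) :=
  if a = b then 0
  else if a = b + 1 ∧ a = b - 1 then (v - u) * (u - v)
  else if a = b + 1 then v - u
  else if a = b - 1 then u - v
  else 1

/-- The correction term in the braid (deformed) relations. -/
def Bpoly (F : Type) [Field F] (e : ℕ) (a b c : ZMod e) (u v w : FreeAlgebra F (Gen e)) :
    FreeAlgebra F (Gen e) :=
  if c = a then
    if a = b + 1 ∧ a = b - 1 then u + w - v - v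
    else if a = b + 1 then 1
    else if a = b - 1 then -1
    else 0
  else 0

/-- The defining relations of the cyclotomic KLR algebra `R_n^Λ` of level `l`,
`Λ = Λ_{κ 0} + ⋯ + Λ_{κ (l-1)}`, for the quiver of type `A_{e-1}^{(1)}`. -/
inductive Rel (F : Type) [Field F] (e : ℕ) [NeZero e] (n l : ℕ) (κ : Fin l → ZMod e) :
    FreeAlgebra F (Gen e) → FreeAlgebra F (Gen e) → Prop
  | idem_mul_eq (i j : ℕ → ZMod e) (h : Agree e n i j) :
      Rel F e n l κ (Ee F e i * Ee F e j) (Ee F e i)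
  | idem_mul_ne (i j : ℕ → ZMod e) (h : ¬ Agree e n i j) :
      Rel F e n l κ (Ee F e i * Ee F e j) 0
  | idem_sum :
      Rel F e n l κ (∑ v : Fin n → ZMod e, Ee F e (extendFin e n v)) 1
  | y_idem (r : ℕ) (i : ℕ → ZMod e) :
      Rel F e n l κ (Yy F e r * Ee F e i) (Ee F e i * Yy F e r)
  | psi_idem (r : ℕ) (i : ℕ → ZMod e) :
      Rel F e n l κ (Pp F e r * Ee F e i) (Ee F e (swapSeq e r i) * Pp F e r)
  | y_y (r s : ℕ) : Rel F e n l κ (Yy F e r * Yy F e s) (Yy F e s * Yy F e r)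
  | psi_y (r s : ℕ) (h : s ≠ r ∧ s ≠ r + 1) :
      Rel F e n l κ (Pp F e r * Yy F e s) (Yy F e s * Pp F e r)
  | psi_psi (r s : ℕ) (h : r + 1 < s ∨ s + 1 < r) :
      Rel F e n l κ (Pp F e r * Pp F e s) (Pp F e s * Pp F e r)
  | y_psi (r : ℕ) (i : ℕ → ZMod e) :
      Rel F e n l κ (Yy F e r * (Pp F e r * Ee F e i))
        (Pp F e r * (Yy F e (r+1) * Ee F e i) - (if i r = i (r+1) then Ee F e i else 0))
  | y_succ_psi (r : ℕ) (i : ℕ → ZMod e) :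
      Rel F e n l κ (Yy F e (r+1) * (Pp F e r * Ee F e i))
        (Pp F e r * (Yy F e r * Ee F e i) + (if i r = i (r+1) then Ee F e i else 0))
  | psi_sq (r : ℕ) (i : ℕ → ZMod e) :
      Rel F e n l κ (Pp F e r * Pp F e r * Ee F e i)
        (Qpoly F e (i r) (i (r+1)) (Yy F e r) (Yy F e (r+1)) * Ee F e i)
  | braid (r : ℕ) (i : ℕ → ZMod e) :
      Rel F e n l κ (Pp F e r * Pp F e (r+1) * Pp F e r * Ee F e i)
        (Pp F e (r+1) * Pp F e r * Pp F e (r+1) * Ee F e i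
          + Bpoly F e (i r) (i (r+1)) (i (r+2)) (Yy F e r) (Yy F e (r+1)) (Yy F e (r+2))
              * Ee F e i)
  | cyclo (i : ℕ → ZMod e) :
      Rel F e n l κ
        (Yy F e 1 ^ (Finset.univ.filter (fun m : Fin l => κ m = i 1)).card * Ee F e i) 0
  | y_zero (r : ℕ) (h : ¬ (1 ≤ r ∧ r ≤ n)) : Rel F e n l κ (Yy F e r) 0
  | psi_zero (r : ℕ) (h : ¬ (1 ≤ r ∧ r ≤ n - 1)) : Rel F e n l κ (Pp F e r) 0

/-- The cyclotomic KLR algebra `R_n^Λ` of level `l` with `e`-multicharge `κ`. -/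
abbrev KLR (F : Type) [Field F] (e : ℕ) [NeZero e] (n l : ℕ) (κ : Fin l → ZMod e) : Type :=
  RingQuot (Rel F e n l κ)

/-- The idempotent generator `e(i)` of `R_n^Λ`. -/
def eIdem (F : Type) [Field F] (e : ℕ) [NeZero e] (n l : ℕ) (κ : Fin l → ZMod e)
    (i : ℕ → ZMod e) : KLR F e n l κ :=
  RingQuot.mkAlgHom F (Rel F e n l κ) (Ee F e i)

/-- The generator `y_r` of `R_n^Λ`. -/
def yGen (F : Type) [Field F] (e : ℕ) [NeZero e] (n l : ℕ) (κ : Fin l → ZMod e)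
    (r : ℕ) : KLR F e n l κ :=
  RingQuot.mkAlgHom F (Rel F e n l κ) (Yy F e r)

/-- The generator `ψ_r` of `R_n^Λ`. -/
def psiGen (F : Type) [Field F] (e : ℕ) [NeZero e] (n l : ℕ) (κ : Fin l → ZMod e)
    (r : ℕ) : KLR F e n l κ :=
  RingQuot.mkAlgHom F (Rel F e n l κ) (Pp F e r)

/-- `ψ_x ψ_{x-1} ⋯ ψ_y` (the empty product `1` if `x < y`). -/
def psid (F : Type) [Field F] (e : ℕ) [NeZero e] (n l : ℕ) (κ : Fin l → ZMod e)
    (x y : ℕ) : KLR F e n l κ :=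
  ((List.range' y (x + 1 - y)).reverse.map (psiGen F e n l κ)).prod

/-- `ψ_y ψ_{y+1} ⋯ ψ_x` (the empty product `1` if `x < y`). -/
def psiu (F : Type) [Field F] (e : ℕ) [NeZero e] (n l : ℕ) (κ : Fin l → ZMod e)
    (y x : ℕ) : KLR F e n l κ :=
  ((List.range' y (x + 1 - y)).map (psiGen F e n l κ)).prod

/-- The residue sequence `i_λ` of the column-initial tableau of the bihook
`λ = ((a,1^b),(c,1^d))`: first down the first column of the second component,
then along its first row, then the same for the first component. -/
def bihookRes (e : ℕ) (κ : Fin 2 → ZMod e) (a b c d : ℕ) : ℕ → ZMod e := fun p =>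
  if p ≤ d + 1 then κ 1 + (((1 : ℤ) - (p : ℤ) : ℤ) : ZMod e)
  else if p ≤ d + c then κ 1 + (((p : ℤ) - (d : ℤ) - 1 : ℤ) : ZMod e)
  else if p ≤ d + c + b + 1 then κ 0 + (((d : ℤ) + (c : ℤ) + 1 - (p : ℤ) : ℤ) : ZMod e)
  else κ 0 + (((p : ℤ) - (d : ℤ) - (c : ℤ) - (b : ℤ) - 1 : ℤ) : ZMod e)

/-- The defining relators of the (column) Specht module `S^λ` for the bihook
`λ = ((a,1^b),(c,1^d))` (Kleshchev–Mathas–Ram presentation): the cyclic generator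
`z_λ` satisfies `e(i_λ) z = z`, `y_r z = 0`, `ψ_r z = 0` for
`r ∉ {d+1, c+d, b+c+d+1}`, and the two Garnir relations
`ψ_1⋯ψ_{d+1} z = 0 = ψ_{c+d+1}⋯ψ_{b+c+d+1} z`. -/
def bihookRels (F : Type) [Field F] (e : ℕ) [NeZero e] (n : ℕ) (κ : Fin 2 → ZMod e)
    (a b c d : ℕ) : Set (KLR F e n 2 κ) :=
  {eIdem F e n 2 κ (bihookRes e κ a b c d) - 1}
    ∪ Set.range (yGen F e n 2 κ)
    ∪ {x | ∃ r : ℕ, 1 ≤ r ∧ r ≤ n - 1 ∧ r ≠ d + 1 ∧ r ≠ c + d ∧ r ≠ b + c + d + 1 ∧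
        x = psiGen F e n 2 κ r}
    ∪ {psiu F e n 2 κ 1 (d+1), psiu F e n 2 κ (c+d+1) (b+c+d+1)}

/-- The left ideal of relators of the bihook Specht module. -/
def bihookIdeal (F : Type) [Field F] (e : ℕ) [NeZero e] (n : ℕ) (κ : Fin 2 → ZMod e)
    (a b c d : ℕ) : Submodule (KLR F e n 2 κ) (KLR F e n 2 κ) :=
  Submodule.span (KLR F e n 2 κ) (bihookRels F e n κ a b c d)

/-- The (column) Specht module `S^λ` of the bihook `λ = ((a,1^b),(c,1^d))`, as the
cyclic `R_n^Λ`-module generated by `z_λ` subject to the defining relations. -/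
abbrev Specht (F : Type) [Field F] (e : ℕ) [NeZero e] (n : ℕ) (κ : Fin 2 → ZMod e)
    (a b c d : ℕ) : Type :=
  KLR F e n 2 κ ⧸ bihookIdeal F e n κ a b c d

/-- The cyclic generator `z_λ` of the Specht module. -/
def zEl (F : Type) [Field F] (e : ℕ) [NeZero e] (n : ℕ) (κ : Fin 2 → ZMod e)
    (a b c d : ℕ) : Specht F e n κ a b c d :=
  Submodule.Quotient.mk 1

/-- A module is decomposable if it is the direct sum of two nonzero submodules. -/
def Decomposable (R M : Type) [Ring R] [AddCommGroup M] [Module R M] : Prop :=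
  ∃ A B : Submodule R M, A ≠ ⊥ ∧ B ≠ ⊥ ∧ A ⊓ B = ⊥ ∧ A ⊔ B = ⊤


/-- Nodes `(m, i, j)`: component `m`, row `i`, column `j` (rows and columns 1-based). -/
abbrev Node : Type := Fin 2 × ℕ × ℕ

/-- The residue `κ_m + j - i` of a node `(m,i,j)`. -/
def resNode (e : ℕ) (κ : Fin 2 → ZMod e) (x : Node) : ZMod e :=
  κ x.1 + (((x.2.2 : ℤ) - (x.2.1 : ℤ) : ℤ) : ZMod e)

/-- The Young diagram of the hook partition `(a, 1^b)`. -/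
def hookD (a b : ℕ) : Finset (ℕ × ℕ) :=
  ((Finset.Icc 1 a).image fun j => (1, j)) ∪ ((Finset.Icc 2 (b + 1)).image fun i => (i, 1))

/-- The Young diagram of the bihook `((a,1^b),(c,1^d))` (component `0` is the first
component `(a,1^b)`, component `1` is the second component `(c,1^d)`). -/
def bihookD (a b c d : ℕ) : Finset Node :=
  ((hookD a b).image fun p => ((0 : Fin 2), p)) ∪
    ((hookD c d).image fun p => ((1 : Fin 2), p))

/-- `t` is a standard tableau of the diagram `D` (with `n` boxes): a bijection from
`D` onto `{1,…,n}` (normalised to be `0` off `D`) whose entries increase along rows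
and down columns within each component. -/
def IsStdTab (D : Finset Node) (n : ℕ) (t : Node → ℕ) : Prop :=
  Set.BijOn t ↑D (Set.Icc 1 n) ∧ (∀ x ∉ D, t x = 0) ∧
    (∀ x : Node, x ∈ D → (x.1, x.2.1, x.2.2 + 1) ∈ D →
      t x < t (x.1, x.2.1, x.2.2 + 1)) ∧
    (∀ x : Node, x ∈ D → (x.1, x.2.1 + 1, x.2.2) ∈ D →
      t x < t (x.1, x.2.1 + 1, x.2.2))

/-- The column-initial tableau `t_λ` of the bihook `((a,1^b),(c,1^d))`: the entries
`1,…,n` are placed in order down consecutive columns, left to right, first in the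
second component and then in the first. -/
def colInit (a b c d : ℕ) : Node → ℕ := fun x =>
  if x ∈ bihookD a b c d then
    (if x.1 = 1 then (if x.2.2 = 1 then x.2.1 else d + x.2.2)
     else (if x.2.2 = 1 then c + d + x.2.1 else b + c + d + x.2.2))
  else 0

/-- The residue sequence of a tableau: `r ↦` the residue of the node containing `r`. -/
def resSeqTab (e : ℕ) (κ : Fin 2 → ZMod e) (D : Finset Node) (t : Node → ℕ) :
    ℕ → ZMod e := fun r => ∑ x ∈ D.filter (fun x => t x = r), resNode e κ x

theorem mem_hook (a b : ℕ) (p : ℕ × ℕ) : p ∈ hookD a b ↔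
    (p.1 = 1 ∧ 1 ≤ p.2 ∧ p.2 ≤ a) ∨ (p.2 = 1 ∧ 2 ≤ p.1 ∧ p.1 ≤ b + 1) := by
  obtain ⟨i, j⟩ := p
  simp only [hookD, Finset.mem_union, Finset.mem_image, Finset.mem_Icc, Prod.mk.injEq]
  constructor
  · rintro (⟨k, hk, rfl, rfl⟩ | ⟨k, hk, rfl, rfl⟩)
    · left; simp; omega
    · right; simp; omega
  · rintro (⟨h1, h2⟩ | ⟨h1, h2⟩)
    · left; exact ⟨j, h2, h1.symm, rfl⟩
    · right; exact ⟨i, h2, rfl, h1.symm⟩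

theorem mem_bihook (a b : ℕ) (x : Node) : x ∈ bihookD a b a b ↔ x.2 ∈ hookD a b := by
  obtain ⟨m, p⟩ := x
  simp only [bihookD, Finset.mem_union, Finset.mem_image, Prod.mk.injEq]
  constructor
  · rintro (⟨q, hq, _, rfl⟩ | ⟨q, hq, _, rfl⟩) <;> exact hq
  · intro h
    fin_cases m
    · left; exact ⟨p, h, rfl, rfl⟩
    · right; exact ⟨p, h, rfl, rfl⟩

def hpos (b : ℕ) (p : ℕ × ℕ) : ℕ := if p.2 = 1 then p.1 else b + p.2

theorem hpos_bd (a b : ℕ) (ha : 1 ≤ a) (p : ℕ × ℕ) (h : p ∈ hookD a b) :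
    1 ≤ hpos b p ∧ hpos b p ≤ a + b := by
  rw [mem_hook] at h
  unfold hpos
  split_ifs <;> omega

theorem hpos_inj (a b : ℕ) (p q : ℕ × ℕ) (h : p ∈ hookD a b) (h' : q ∈ hookD a b)
    (hh : hpos b p = hpos b q) : p = q := by
  rw [mem_hook] at h h'
  unfold hpos at hh
  ext <;> split_ifs at hh <;> omega

theorem hpos_surj (a b : ℕ) (ha : 1 ≤ a) (r : ℕ) (h1 : 1 ≤ r) (h2 : r ≤ a + b) :
    ∃ p ∈ hookD a b, hpos b p = r := by
  by_cases h : r ≤ b + 1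
  · refine ⟨(r, 1), ?_, by simp [hpos]⟩
    rw [mem_hook]; grind
  · refine ⟨(1, r - b), ?_, ?_⟩
    · rw [mem_hook]; grind
    · unfold hpos; simp only; split_ifs <;> omega

def swT (a b : ℕ) (m : Fin 2) : Node → ℕ := fun x =>
  if x ∈ bihookD a b a b then (if x.1 = m then hpos b x.2 else a + b + hpos b x.2) else 0

theorem colInit_eq (a b : ℕ) : colInit a b a b = swT a b 1 := by
  funext ⟨m, i, j⟩
  unfold colInit swT hpos
  simp only
  split_ifs <;> omega

theorem swap_eq (a b : ℕ) : (fun x : Node => if x ∈ bihookD a b a b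
          then colInit a b a b (x.1 + 1, x.2) else 0) = swT a b 0 := by
  funext x
  rw [colInit_eq]
  unfold swT
  by_cases h : x ∈ bihookD a b a b
  · have h' : ((x.1 + 1, x.2) : Node) ∈ bihookD a b a b := by
      rw [mem_bihook] at h ⊢; exact h
    simp only [h, h', if_true]
    obtain ⟨m, p⟩ := x
    fin_cases m <;> simp
  · simp [h]

theorem swT_std (a b : ℕ) (ha : 1 ≤ a) (m : Fin 2) :
    IsStdTab (bihookD a b a b) (2 * (a + b)) (swT a b m) := by
  refine ⟨⟨?_, ?_, ?_⟩, ?_, ?_, ?_⟩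
  · intro x hx
    have hx' : x ∈ bihookD a b a b := hx
    have := hpos_bd a b ha x.2 ((mem_bihook a b x).1 hx')
    simp only [swT, hx', if_true, Set.mem_Icc]
    split_ifs <;> omega
  · intro x hx y hy hxy
    have hx' : x ∈ bihookD a b a b := hx
    have hy' : y ∈ bihookD a b a b := hy
    have h1 := (mem_bihook a b x).1 hx'
    have h2 := (mem_bihook a b y).1 hy'
    have b1 := hpos_bd a b ha x.2 h1
    have b2 := hpos_bd a b ha y.2 h2
    simp only [swT, hx', hy', if_true] at hxy
    have key : x.1 = y.1 ∧ hpos b x.2 = hpos b y.2 := by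
      split_ifs at hxy <;> constructor <;> omega
    exact Prod.ext key.1 (hpos_inj a b _ _ h1 h2 key.2)
  · intro r hr
    obtain ⟨r1, r2⟩ := hr
    by_cases h : r ≤ a + b
    · obtain ⟨p, hp, hr⟩ := hpos_surj a b ha r r1 h
      have hm : ((m, p) : Node) ∈ bihookD a b a b := (mem_bihook a b _).2 hp
      exact ⟨(m, p), hm, by simp [swT, hm, hr]⟩
    · obtain ⟨p, hp, hr⟩ := hpos_surj a b ha (r - (a + b)) (by omega) (by omega)
      have hm : ((m + 1, p) : Node) ∈ bihookD a b a b := (mem_bihook a b _).2 hp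
      refine ⟨(m + 1, p), hm, ?_⟩
      have : m + 1 ≠ m := by omega
      simp only [swT, hm, hr, this, if_true, if_false]
      omega
  · intro x hx
    simp [swT, hx]
  · intro x hx hy
    have h1 := (mem_bihook a b x).1 hx
    have h2 := (mem_bihook a b _).1 hy
    simp only [swT, hx, hy, if_true]
    rw [mem_hook] at h1 h2
    unfold hpos
    simp only at *
    split_ifs <;> omega
  · intro x hx hy
    have h1 := (mem_bihook a b x).1 hx
    have h2 := (mem_bihook a b _).1 hy
    simp only [swT, hx, hy, if_true]
    rw [mem_hook] at h1 h2
    unfold hpos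
    simp only at *
    split_ifs <;> omega

theorem res_at (e : ℕ) (κ : Fin 2 → ZMod e) (D : Finset Node) (n : ℕ) (t : Node → ℕ)
    (ht : IsStdTab D n t) (x : Node) (hx : x ∈ D) :
    resSeqTab e κ D t (t x) = resNode e κ x := by
  unfold resSeqTab
  have : D.filter (fun y => t y = t x) = {x} := by
    ext y
    simp only [Finset.mem_filter, Finset.mem_singleton]
    constructor
    · rintro ⟨h1, h2⟩
      exact ht.1.2.1 h1 hx h2
    · rintro rfl
      exact ⟨hx, rfl⟩
  rw [this, Finset.sum_singleton]

theorem res_inj (e a b : ℕ) (hab : a + b ≤ e) (x y : Node)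
    (hx : x ∈ bihookD a b a b) (hy : y ∈ bihookD a b a b)
    (h : resNode e (fun _ => 0) x = resNode e (fun _ => 0) y) : x.2 = y.2 := by
  rw [mem_bihook, mem_hook] at hx hy
  unfold resNode at h
  rw [zero_add, zero_add, ZMod.intCast_eq_intCast_iff_dvd_sub] at h
  have h0 := Int.eq_zero_of_abs_lt_dvd h (by rw [abs_lt]; constructor <;> omega)
  ext <;> omega

theorem res_swT (e a b : ℕ) : resSeqTab e (fun _ => 0) (bihookD a b a b) (swT a b 0) =
    resSeqTab e (fun _ => 0) (bihookD a b a b) (swT a b 1) := by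
  funext r
  unfold resSeqTab
  have inv : ∀ m : Fin 2, m + 1 + 1 = m := by decide
  have e1 : ∀ x : Node, (((x.1 + 1, x.2) : Node) ∈ bihookD a b a b) = (x ∈ bihookD a b a b) := by
    intro x
    simp only [mem_bihook]
  have e2 : ∀ x : Node, swT a b 1 (x.1 + 1, x.2) = swT a b 0 x := by
    intro x
    rw [← swap_eq, colInit_eq]
    by_cases h : x ∈ bihookD a b a b
    · simp [h]
    · simp only [h, if_false]
      simp only [swT, e1, h, if_false]
  have e3 : ∀ x : Node, swT a b 0 (x.1 + 1, x.2) = swT a b 1 x := by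
    intro x
    rw [← e2]; simp only [inv]
  refine Finset.sum_nbij' (fun x => (x.1 + 1, x.2)) (fun x => (x.1 + 1, x.2)) ?_ ?_ ?_ ?_ ?_
  · intro x hx
    simp only [Finset.mem_filter] at hx ⊢
    rw [e1, e2]; exact hx
  · intro x hx
    simp only [Finset.mem_filter] at hx ⊢
    rw [e1, e3]; exact hx
  · intro x _
    simp only [inv]
  · intro x _
    simp only [inv]
  · intro x _
    simp [resNode]

theorem corner_le (a b n : ℕ) (ha : 1 ≤ a) (t : Node → ℕ) (ht : IsStdTab (bihookD a b a b) n t)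
    (m : Fin 2) (p : ℕ × ℕ) (hp : p ∈ hookD a b) : t (m, 1, 1) ≤ t (m, p) := by
  have row : ∀ j, j + 1 ≤ a → t (m, 1, 1) ≤ t (m, 1, j + 1) := by
    intro j
    induction j with
    | zero => intro _; exact le_rfl
    | succ k ih =>
      intro hk
      refine (ih (by omega)).trans (ht.2.2.1 (m, 1, k + 1) ?_ ?_).le <;>
      · rw [mem_bihook, mem_hook]; grind
  obtain ⟨i, j⟩ := p
  rw [mem_hook] at hp
  simp only at hp
  have col : ∀ i, i + 1 ≤ b + 1 → t (m, 1, 1) ≤ t (m, i + 1, 1) := by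
    intro i
    induction i with
    | zero => intro _; exact le_rfl
    | succ k ih =>
      intro hk
      refine (ih (by omega)).trans (ht.2.2.2 (m, k + 1, 1) ?_ ?_).le <;>
      · rw [mem_bihook, mem_hook]; grind
  rcases hp with ⟨rfl, h1, h2⟩ | ⟨rfl, h1, h2⟩
  · obtain ⟨k, rfl⟩ : ∃ k, j = k + 1 := ⟨j - 1, by omega⟩
    exact row k h2
  · obtain ⟨k, rfl⟩ : ∃ k, i = k + 1 := ⟨i - 1, by omega⟩
    exact col k h2

theorem tab_class (e a b : ℕ) (ha : 1 ≤ a) (hab : a + b ≤ e) (t : Node → ℕ)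
    (ht : IsStdTab (bihookD a b a b) (2 * (a + b)) t)
    (hr : resSeqTab e (fun _ => 0) (bihookD a b a b) t =
      resSeqTab e (fun _ => 0) (bihookD a b a b) (swT a b 1)) :
    t = swT a b 0 ∨ t = swT a b 1 := by
  have hs := swT_std a b ha 1
  have key : ∀ m p, p ∈ hookD a b → t (m, p) = hpos b p ∨ t (m, p) = a + b + hpos b p := by
    intro m p hp
    have hx : ((m, p) : Node) ∈ bihookD a b a b := (mem_bihook a b _).2 hp
    obtain ⟨y, hy, hyt⟩ := hs.1.2.2 (ht.1.1 hx)
    have hy' : y ∈ bihookD a b a b := hy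
    have h1 := res_at e (fun _ => 0) _ _ t ht _ hx
    rw [hr, ← hyt, res_at e (fun _ => 0) _ _ _ hs _ hy'] at h1
    have h2 := res_inj e a b hab _ _ hy' hx h1
    simp only at h2
    rw [← hyt, ← h2]
    simp only [swT, hy', if_true]
    split_ifs <;> simp
  have inj : ∀ m p, p ∈ hookD a b → t (m, p) ≠ t (m + 1, p) := by
    intro m p hp h
    have := ht.1.2.1 ((mem_bihook a b (m, p)).2 hp) ((mem_bihook a b (m + 1, p)).2 hp) h
    have h2 : m = m + 1 := congrArg Prod.fst this
    omega
  have hc : ((1, 1) : ℕ × ℕ) ∈ hookD a b := by rw [mem_hook]; grind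
  have fin : ∀ m : Fin 2, t (m + 1, 1, 1) = a + b + 1 → t = swT a b m := by
    intro m hm
    funext x
    by_cases hx : x ∈ bihookD a b a b
    · have hp := (mem_bihook a b x).1 hx
      have h1 := corner_le a b _ ha t ht (m + 1) x.2 hp
      have h2 := key m x.2 hp
      have h3 := key (m + 1) x.2 hp
      have h4 := inj m x.2 hp
      have h5 := hpos_bd a b ha _ hp
      simp only [swT, hx, if_true]
      obtain ⟨m', p⟩ := x
      simp only at *
      split_ifs with h
      · subst h; omega
      · have : m' = m + 1 := by omega
        subst this; omega
    · rw [ht.2.1 x hx]; simp [swT, hx]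
  have c0 := key 0 _ hc
  have c1 := key 1 _ hc
  have c2 := inj 0 _ hc
  have hh : hpos b (1, 1) = 1 := by simp [hpos]
  rw [hh] at c0 c1
  simp only [zero_add] at c2
  by_cases h : t (1, 1, 1) = a + b + 1
  · left; exact fin 0 h
  · right; apply fin 1
    change t (0, 1, 1) = _
    omega

/-- **Lemma.** Let `κ = (0,0)`, `a ≥ 1`, `b ≥ 0` with `a + b ≤ e`, and
`λ = ((a,1^b),(a,1^b))`.  Then there is a unique standard `λ`-tableau `t ≠ t_λ` with
residue sequence `i_t = i_λ`; namely the tableau obtained from `t_λ` by swapping the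
two components. -/
theorem unique_tableau_switch (e : ℕ) [NeZero e] (he : 2 ≤ e)
    (κ : Fin 2 → ZMod e) (hκ : κ = fun _ => 0)
    (a b : ℕ) (ha : 1 ≤ a) (hab : a + b ≤ e)
    (n : ℕ) (hn : n = 2 * (a + b)) :
    (KLRSpecht.IsStdTab (KLRSpecht.bihookD a b a b) n
        (fun x => if x ∈ KLRSpecht.bihookD a b a b
          then KLRSpecht.colInit a b a b (x.1 + 1, x.2) else 0)
      ∧ (fun x : KLRSpecht.Node => if x ∈ KLRSpecht.bihookD a b a b
          then KLRSpecht.colInit a b a b (x.1 + 1, x.2) else 0) ≠ KLRSpecht.colInit a b a b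
      ∧ KLRSpecht.resSeqTab e κ (KLRSpecht.bihookD a b a b)
          (fun x => if x ∈ KLRSpecht.bihookD a b a b
            then KLRSpecht.colInit a b a b (x.1 + 1, x.2) else 0)
        = KLRSpecht.resSeqTab e κ (KLRSpecht.bihookD a b a b) (KLRSpecht.colInit a b a b))
    ∧ (∀ t : KLRSpecht.Node → ℕ,
        KLRSpecht.IsStdTab (KLRSpecht.bihookD a b a b) n t →
        t ≠ KLRSpecht.colInit a b a b →
        KLRSpecht.resSeqTab e κ (KLRSpecht.bihookD a b a b) t
          = KLRSpecht.resSeqTab e κ (KLRSpecht.bihookD a b a b) (KLRSpecht.colInit a b a b) →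
        t = fun x => if x ∈ KLRSpecht.bihookD a b a b
          then KLRSpecht.colInit a b a b (x.1 + 1, x.2) else 0) := by
  subst hκ hn
  rw [swap_eq, colInit_eq]
  refine ⟨⟨swT_std a b ha 0, ?_, res_swT e a b⟩, ?_⟩
  · intro h
    have h1 := congrFun h (0, 1, 1)
    have hc : ((0, 1, 1) : Node) ∈ bihookD a b a b := by
      rw [mem_bihook, mem_hook]; grind
    simp [swT, hc] at h1
    omega
  · intro t ht hne hr
    exact (tab_class e a b ha hab t ht hr).resolve_right hne
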